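/- Let N ≥ 1 and let w₁ = (α₁,…,α_p) and w₂ = (β₁,…,β_q) be words with letters in μ_N such that α_p ≠ 1 and β_q ≠ 1. For a word w = (γ₁,…,γ_k) with letters in μ_N and γ_k ≠ 1, let I(w) = ∫_{0 < t₁ < ⋯ < t_k < 1} ∏_{i=1}^k (γ_i − t_i)^{−1} dt₁⋯dt_k (which converges). Then I(w₁)·I(w₂) = ∑_w I(w), where the sum runs over all shuffles of w₁ and w₂, i.e. over all words of length p+q obtained by interleaving the letters of w₁ and w₂ while preserving the internal order of each, counted with multiplicity (there are binom(p+q, p) terms). Each such shuffle ends in α_p or β_q, hence its last letter is ≠ 1 and its integral converges. -/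

import Mathlib

open Filter Topology MeasureTheory

/-- The list of all shuffles of two words, with multiplicity. -/
def shuffles {α : Type*} : List α → List α → List (List α)
  | [], l₂ => [l₂]
  | l₁, [] => [l₁]
  | a :: l₁, b :: l₂ =>
      (shuffles l₁ (b :: l₂)).map (a :: ·) ++ (shuffles (a :: l₁) l₂).map (b :: ·)
  termination_by l₁ l₂ => l₁.length + l₂.length

/-- The open unit simplex `{t : 0 < t₁ < ⋯ < t_k < 1}`. -/
def openSimplex (k : ℕ) : Set (Fin k → ℝ) :=
  {t | (∀ i, 0 < t i ∧ t i < 1) ∧ ∀ i j : Fin k, i < j → t i < t j}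

/-- The iterated integral `I(w) = ∫_{0<t₁<⋯<t_k<1} ∏ᵢ (γᵢ - tᵢ)⁻¹ dt` attached to a word
`w = (γ₁,…,γ_k)`. -/
noncomputable def wordIntegral (w : List ℂ) : ℂ :=
  ∫ t in openSimplex w.length, ∏ i, (w.get i - (t i : ℂ))⁻¹

/-- Simplex with lower bound `s`. -/
def simplexFrom (k : ℕ) (s : ℝ) : Set (Fin k → ℝ) :=
  {t | (∀ i, s < t i ∧ t i < 1) ∧ ∀ i j : Fin k, i < j → t i < t j}

lemma simp_cons (k : ℕ) (s x : ℝ) (t : Fin k → ℝ) :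
    (Fin.cons x t : Fin (k+1) → ℝ) ∈ simplexFrom (k+1) s ↔ x ∈ Set.Ioo s 1 ∧ t ∈ simplexFrom k x := by
  simp only [simplexFrom, Set.mem_ofPred_eq, Fin.forall_fin_succ, Fin.cons_zero, Fin.cons_succ, Set.mem_Ioo]
  constructor
  · rintro ⟨⟨h0, h1⟩, ⟨_, h2⟩, h3⟩
    exact ⟨h0, fun i => ⟨h2 i (Fin.succ_pos i), (h1 i).2⟩, fun i j hij => (h3 i).2 j (Fin.succ_lt_succ_iff.2 hij)⟩
  · rintro ⟨h0, h1, h2⟩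
    refine ⟨⟨h0, fun i => ⟨h0.1.trans (h1 i).1, (h1 i).2⟩⟩, ⟨fun h => absurd h (lt_irrefl _), fun i _ => (h1 i).1⟩,
      fun i => ⟨fun h => absurd h (Fin.not_lt_zero _), fun j hj => h2 i j (Fin.succ_lt_succ_iff.1 hj)⟩⟩

lemma simp_meas (k : ℕ) (s : ℝ) : MeasurableSet (simplexFrom k s) := by
  have : simplexFrom k s = (⋂ i, ({t | s < t i} ∩ {t | t i < 1})) ∩
      ⋂ i, ⋂ j, {t | i < j → t i < t j} := by
    ext t; simp [simplexFrom]
  rw [this]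
  refine MeasurableSet.inter (MeasurableSet.iInter fun i => ?_)
    (MeasurableSet.iInter fun i => MeasurableSet.iInter fun j => ?_)
  · exact (measurableSet_lt measurable_const (measurable_pi_apply i)).inter
      (measurableSet_lt (measurable_pi_apply i) measurable_const)
  · by_cases h : i < j
    · simpa [h] using measurableSet_lt (measurable_pi_apply i) (measurable_pi_apply j)
    · simp [h]

noncomputable def GG (w : List ℂ) (s : ℝ) (t : Fin w.length → ℝ) : ℂ :=
  (simplexFrom w.length s).indicator (fun t => ∏ i, (w.get i - (t i : ℂ))⁻¹) t

lemma GG_meas (w : List ℂ) (s : ℝ) : Measurable (GG w s) := by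
  refine Measurable.indicator ?_ (simp_meas _ _)
  refine Finset.measurable_prod _ fun i _ => ?_
  exact (measurable_const.sub (Complex.measurable_ofReal.comp (measurable_pi_apply i))).inv

lemma GG_cons (a : ℂ) (w : List ℂ) (s x : ℝ) (t : Fin w.length → ℝ) :
    GG (a :: w) s (Fin.cons x t : Fin (w.length + 1) → ℝ) =
      (Set.Ioo s 1).indicator (fun x : ℝ => (a - (x:ℂ))⁻¹) x * GG w x t := by
  change (simplexFrom (w.length + 1) s).indicator (fun t => ∏ i : Fin (w.length + 1), ((a :: w).get i - (t i : ℂ))⁻¹) _ = _ * (simplexFrom w.length x).indicator _ t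
  by_cases h1 : x ∈ Set.Ioo s 1 <;> by_cases h2 : t ∈ simplexFrom w.length x
  · rw [Set.indicator_of_mem ((simp_cons _ _ _ _).2 ⟨h1, h2⟩), Set.indicator_of_mem h1,
      Set.indicator_of_mem h2]
    exact Fin.prod_univ_succ _
  · rw [Set.indicator_of_notMem (fun h => h2 ((simp_cons _ _ _ _).1 h).2),
      Set.indicator_of_notMem h2, mul_zero]
  · rw [Set.indicator_of_notMem (fun h => h1 ((simp_cons _ _ _ _).1 h).1),
      Set.indicator_of_notMem h1, zero_mul]
  · rw [Set.indicator_of_notMem (fun h => h2 ((simp_cons _ _ _ _).1 h).2),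
      Set.indicator_of_notMem h2, mul_zero]

noncomputable def NN (w : List ℂ) (s : ℝ) : ENNReal := ∫⁻ t, ‖GG w s t‖ₑ
noncomputable def JJ (w : List ℂ) (s : ℝ) : ℂ := ∫ t, GG w s t

/-- splitting off the first coordinate -/
def ee (k : ℕ) : (ℝ × (Fin k → ℝ)) ≃ᵐ (Fin (k+1) → ℝ) :=
  (MeasurableEquiv.piFinSuccAbove (fun _ => ℝ) 0).symm

lemma ee_apply (k : ℕ) (p : ℝ × (Fin k → ℝ)) : ee k p = Fin.cons p.1 p.2 := by
  simp [ee, MeasurableEquiv.piFinSuccAbove]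
  rfl

lemma ee_mp (k : ℕ) : MeasurePreserving (ee k) (volume.prod volume) volume :=
  (volume_preserving_piFinSuccAbove (fun _ : Fin (k+1) => ℝ) 0).symm

noncomputable def HH (a : ℂ) (w : List ℂ) (s : ℝ) (p : ℝ × (Fin w.length → ℝ)) : ℂ :=
  (Set.Ioo s 1).indicator (fun x : ℝ => (a - (x:ℂ))⁻¹) p.1 * GG w p.1 p.2

lemma HH_eq (a : ℂ) (w : List ℂ) (s : ℝ) : HH a w s = GG (a :: w) s ∘ ee w.length := by
  funext p
  rw [Function.comp, ee_apply]
  exact (GG_cons a w s p.1 p.2).symm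

lemma HH_meas (a : ℂ) (w : List ℂ) (s : ℝ) : Measurable (HH a w s) := by
  rw [HH_eq]; exact (GG_meas (a :: w) s).comp (ee w.length).measurable

lemma NN_cons (a : ℂ) (w : List ℂ) (s : ℝ) :
    NN (a :: w) s = ∫⁻ x in Set.Ioo s 1, ‖(a - (x:ℂ))⁻¹‖ₑ * NN w x := by
  have h := (ee_mp w.length).lintegral_comp_emb (ee w.length).measurableEmbedding
    (fun t => ‖GG (a :: w) s t‖ₑ)
  have h2 : NN (a :: w) s = ∫⁻ p, ‖HH a w s p‖ₑ ∂(volume.prod volume) := by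
    rw [HH_eq]; exact h.symm
  rw [h2, lintegral_prod _ (HH_meas a w s).enorm.aemeasurable, ← lintegral_indicator measurableSet_Ioo]
  congr 1
  funext x
  by_cases hx : x ∈ Set.Ioo s 1
  · simp only [HH, Set.indicator_of_mem hx, enorm_mul, NN]
    exact lintegral_const_mul _ (GG_meas w x).enorm
  · simp [HH, Set.indicator_of_notMem hx]

lemma GG_int (w : List ℂ) (s : ℝ) (h : NN w s ≠ ⊤) : Integrable (GG w s) :=
  ⟨(GG_meas w s).aestronglyMeasurable, lt_top_iff_ne_top.2 h⟩

lemma HH_int (a : ℂ) (w : List ℂ) (s : ℝ) (h : NN (a :: w) s ≠ ⊤) :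
    Integrable (HH a w s) (volume.prod volume) := by
  rw [HH_eq]
  exact ((ee_mp w.length).integrable_comp_emb (ee w.length).measurableEmbedding).2
    (GG_int (a :: w) s h)

lemma HH_inner (a : ℂ) (w : List ℂ) (s : ℝ) (x : ℝ) : ∫ t, HH a w s (x, t) =
    (Set.Ioo s 1).indicator (fun x : ℝ => (a - (x:ℂ))⁻¹ * JJ w x) x := by
  by_cases hx : x ∈ Set.Ioo s 1
  · simp only [HH, Set.indicator_of_mem hx, JJ]
    exact integral_const_mul _ _
  · simp [HH, Set.indicator_of_notMem hx]

lemma K_int (a : ℂ) (w : List ℂ) (s : ℝ) (h : NN (a :: w) s ≠ ⊤) :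
    IntegrableOn (fun x : ℝ => (a - (x:ℂ))⁻¹ * JJ w x) (Set.Ioo s 1) := by
  rw [← integrable_indicator_iff measurableSet_Ioo]
  have := (HH_int a w s h).integral_prod_left
  simpa only [HH_inner] using this

lemma JJ_cons (a : ℂ) (w : List ℂ) (s : ℝ) (h : NN (a :: w) s ≠ ⊤) :
    JJ (a :: w) s = ∫ x in Set.Ioo s 1, (a - (x:ℂ))⁻¹ * JJ w x := by
  have h1 := (ee_mp w.length).integral_comp (ee w.length).measurableEmbedding
    (fun t => GG (a :: w) s t)
  have h2 : JJ (a :: w) s = ∫ p, HH a w s p ∂(volume.prod volume) := by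
    rw [HH_eq]; exact h1.symm
  rw [h2, integral_prod _ (HH_int a w s h), ← integral_indicator measurableSet_Ioo]
  congr 1
  funext x
  exact HH_inner a w s x

def Good : List ℂ → Prop
  | [] => True
  | a :: w => ‖a‖ = 1 ∧ (w = [] → a ≠ 1) ∧ Good w

lemma one_sub_le (a : ℂ) (ha : ‖a‖ = 1) (t : ℝ) (h0 : 0 ≤ t) : 1 - t ≤ ‖a - (t:ℂ)‖ := by
  have := norm_sub_norm_le a (t:ℂ)
  rw [ha, Complex.norm_real, Real.norm_of_nonneg h0] at this
  exact this

lemma ne_of_good (a : ℂ) (ha : ‖a‖ = 1) (t : ℝ) (h0 : 0 ≤ t) (h1 : t < 1) : a - (t:ℂ) ≠ 0 := by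
  have := one_sub_le a ha t h0
  rw [← norm_pos_iff]; linarith

lemma vol_nil : (volume : Measure (Fin ([] : List ℂ).length → ℝ)) Set.univ = 1 := by
  have : (volume : Measure (Fin 0 → ℝ)) Set.univ = 1 := by
    rw [← Set.pi_univ Set.univ, volume_pi_pi]
    simp
  exact this

lemma NN_nil (s : ℝ) : NN [] s = 1 := by
  have h : ∀ t, GG [] s t = 1 := fun t => by
    unfold GG
    rw [Set.indicator_of_mem]
    · exact Finset.prod_empty
    · exact ⟨fun i => i.elim0, fun i => i.elim0⟩
  simp only [NN, h]
  simp only [enorm_one, lintegral_const, one_mul]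
  exact vol_nil

lemma JJ_nil (s : ℝ) : JJ [] s = 1 := by
  have h : ∀ t, GG [] s t = 1 := fun t => by
    unfold GG
    rw [Set.indicator_of_mem]
    · exact Finset.prod_empty
    · exact ⟨fun i => i.elim0, fun i => i.elim0⟩
  simp only [JJ, h]
  rw [integral_const, Measure.real, vol_nil]
  simp

lemma NN_cons_le (a : ℂ) (w : List ℂ) (C : ℝ) (s : ℝ) (hs : 0 ≤ s) (hC : 0 ≤ C)
    (h : ∀ t : ℝ, 0 ≤ t → t < 1 → ‖(a - (t:ℂ))⁻¹‖ₑ * NN w t ≤ ENNReal.ofReal C) :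
    NN (a :: w) s ≤ ENNReal.ofReal (C * (1 - s)) := by
  rw [NN_cons]
  calc _ ≤ ∫⁻ x in Set.Ioo s 1, ENNReal.ofReal C :=
        setLIntegral_mono measurable_const fun x hx => h x (hs.trans hx.1.le) hx.2
    _ = _ := by
        rw [setLIntegral_const, Real.volume_Ioo, ENNReal.ofReal_mul hC]

lemma kernel_bound (w : List ℂ) : ∀ a, Good (a :: w) → ∃ C : ℝ, 0 ≤ C ∧
    ∀ t : ℝ, 0 ≤ t → t < 1 → ‖(a - (t:ℂ))⁻¹‖ₑ * NN w t ≤ ENNReal.ofReal C := by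
  induction w with
  | nil =>
    intro a ⟨ha, h1, _⟩
    have h1 := h1 rfl
    have hne : ∀ t ∈ Set.Icc (0:ℝ) 1, a - (t:ℂ) ≠ 0 := by
      intro t ht h
      rcases eq_or_lt_of_le ht.2 with rfl | h2
      · exact h1 (by simpa [sub_eq_zero] using h)
      · exact ne_of_good a ha t ht.1 h2 h
    have hc : ContinuousOn (fun t : ℝ => (a - (t:ℂ))⁻¹) (Set.Icc 0 1) :=
      ContinuousOn.inv₀ (by fun_prop) hne
    obtain ⟨C, hC⟩ := isCompact_Icc.exists_bound_of_continuousOn hc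
    refine ⟨C, (norm_nonneg _).trans (hC 0 (by simp)), fun t h0 h1 => ?_⟩
    rw [NN_nil, mul_one, ← ofReal_norm]
    exact ENNReal.ofReal_le_ofReal (hC t ⟨h0, h1.le⟩)
  | cons b w ih =>
    intro a ⟨ha, _, hg⟩
    obtain ⟨C, hC0, hC⟩ := ih b hg
    refine ⟨C, hC0, fun t h0 h1 => ?_⟩
    calc _ ≤ ‖(a - (t:ℂ))⁻¹‖ₑ * ENNReal.ofReal (C * (1 - t)) := by
          gcongr; exact NN_cons_le b w C t h0 hC0 hC
      _ = ENNReal.ofReal (‖(a - (t:ℂ))⁻¹‖ * (C * (1 - t))) := by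
          rw [← ofReal_norm, ENNReal.ofReal_mul (norm_nonneg _)]
      _ ≤ _ := by
          apply ENNReal.ofReal_le_ofReal
          have h2 := one_sub_le a ha t h0
          have h3 : 0 < 1 - t := by linarith
          rw [norm_inv, inv_mul_le_iff₀ (by linarith), mul_comm]
          exact mul_le_mul_of_nonneg_right h2 hC0

lemma NN_fin (w : List ℂ) (hw : Good w) (s : ℝ) (hs : 0 ≤ s) : NN w s ≠ ⊤ := by
  cases w with
  | nil => simp [NN_nil]
  | cons a w =>
    obtain ⟨C, h0, hC⟩ := kernel_bound w a hw
    exact ne_top_of_le_ne_top ENNReal.ofReal_ne_top (NN_cons_le a w C s hs h0 hC)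

lemma K_ii (a : ℂ) (w : List ℂ) (h : Good (a :: w)) (s : ℝ) (hs : s ∈ Set.Icc (0:ℝ) 1) :
    IntervalIntegrable (fun x : ℝ => (a - (x:ℂ))⁻¹ * JJ w x) volume s 1 := by
  rw [intervalIntegrable_iff_integrableOn_Ioo_of_le hs.2]
  exact K_int a w s (NN_fin _ h s hs.1)

lemma JJ_cons' (a : ℂ) (w : List ℂ) (h : Good (a :: w)) (s : ℝ) (hs : s ∈ Set.Icc (0:ℝ) 1) :
    JJ (a :: w) s = ∫ x in s..1, (a - (x:ℂ))⁻¹ * JJ w x := by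
  rw [JJ_cons a w s (NN_fin _ h s hs.1), intervalIntegral.integral_of_le hs.2,
    integral_Ioc_eq_integral_Ioo]

lemma JJ_cont (w : List ℂ) (h : Good w) : ContinuousOn (JJ w) (Set.Icc 0 1) := by
  cases w with
  | nil => simpa only [funext JJ_nil] using continuousOn_const
  | cons a w =>
    refine ContinuousOn.congr ?_ (fun s hs => JJ_cons' a w h s hs)
    have := intervalIntegral.continuousOn_primitive_interval_left (μ := volume) (a := 0) (b := 1)
      (f := fun x : ℝ => (a - (x:ℂ))⁻¹ * JJ w x) ?_
    · simpa using this
    · have := K_ii a w h 0 (by simp)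
      rwa [intervalIntegrable_iff'] at this

lemma JJ_deriv (a : ℂ) (w : List ℂ) (h : Good (a :: w)) (s : ℝ) (hs : s ∈ Set.Ioo (0:ℝ) 1) :
    HasDerivAt (JJ (a :: w)) (-((a - (s:ℂ))⁻¹ * JJ w s)) s := by
  have hc : ContinuousOn (fun x : ℝ => (a - (x:ℂ))⁻¹ * JJ w x) (Set.Ioo 0 1) :=
    (ContinuousOn.inv₀ (by fun_prop) fun t ht => ne_of_good a h.1 t ht.1.le ht.2).mul
      ((JJ_cont w h.2.2).mono Set.Ioo_subset_Icc_self)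
  have h1 := intervalIntegral.integral_hasDerivAt_left (K_ii a w h s ⟨hs.1.le, hs.2.le⟩)
    (hc.stronglyMeasurableAtFilter isOpen_Ioo s hs)
    (hc.continuousAt (Ioo_mem_nhds hs.1 hs.2))
  refine h1.congr_of_eventuallyEq ?_
  filter_upwards [Ioo_mem_nhds hs.1 hs.2] with x hx
  exact JJ_cons' a w h x ⟨hx.1.le, hx.2.le⟩

lemma JJ_one (a : ℂ) (w : List ℂ) (h : Good (a :: w)) : JJ (a :: w) 1 = 0 := by
  rw [JJ_cons' a w h 1 (by simp), intervalIntegral.integral_same]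

lemma sum_deriv (a : ℂ) (s : ℝ) (hs : s ∈ Set.Ioo (0:ℝ) 1) (L : List (List ℂ))
    (hL : ∀ w ∈ L, Good (a :: w)) :
    HasDerivAt (fun x => ((L.map (a :: ·)).map (JJ · x)).sum)
      (-((a - (s:ℂ))⁻¹ * (L.map (JJ · s)).sum)) s := by
  induction L with
  | nil => simpa using hasDerivAt_const s (0:ℂ)
  | cons w L ih =>
    have h1 := (JJ_deriv a w (hL w (by simp)) s hs).add (ih fun w' h' => hL w' (by simp [h']))
    simp only [List.map_cons, List.sum_cons]
    exact h1.congr_deriv (by ring)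

lemma sum_cont (L : List (List ℂ)) (hL : ∀ w ∈ L, Good w) :
    ContinuousOn (fun x => (L.map (JJ · x)).sum) (Set.Icc 0 1) := by
  induction L with
  | nil => simpa using continuousOn_const
  | cons w L ih =>
    simp only [List.map_cons, List.sum_cons]
    exact (JJ_cont w (hL w (by simp))).add (ih fun w' h' => hL w' (by simp [h']))

lemma sum_one (a : ℂ) (L : List (List ℂ)) (hL : ∀ w ∈ L, Good (a :: w)) :
    ((L.map (a :: ·)).map (JJ · 1)).sum = 0 := by
  induction L with
  | nil => simp
  | cons w L ih =>
    simp only [List.map_cons, List.sum_cons]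
    rw [JJ_one a w (hL w (by simp)), ih fun w' h' => hL w' (by simp [h']), zero_add]

lemma shuffles_ne (w₁ w₂ : List ℂ) (h : w₁ ≠ [] ∨ w₂ ≠ []) : ∀ w ∈ shuffles w₁ w₂, w ≠ [] := by
  intro w hw
  cases w₁ with
  | nil => simp [shuffles] at hw h; rwa [hw]
  | cons a w₁ =>
    cases w₂ with
    | nil => simp [shuffles] at hw; simp [hw]
    | cons b w₂ =>
      simp only [shuffles, List.mem_append, List.mem_map] at hw
      rcases hw with ⟨v, _, rfl⟩ | ⟨v, _, rfl⟩ <;> simp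

lemma shuffle_main (w₁ w₂ : List ℂ) : Good w₁ → Good w₂ →
    (∀ w ∈ shuffles w₁ w₂, Good w) ∧ ∀ s ∈ Set.Icc (0:ℝ) 1,
      JJ w₁ s * JJ w₂ s = ((shuffles w₁ w₂).map (JJ · s)).sum := by
  induction w₁, w₂ using shuffles.induct with
  | case1 l₂ =>
    intro _ h2
    simp [shuffles, h2, JJ_nil]
  | case2 l₁ hne =>
    intro h1 _
    cases l₁ <;> simp [shuffles, h1, JJ_nil]
  | case3 a l₁ b l₂ ih1 ih2 =>
    intro h1 h2
    obtain ⟨g1, e1⟩ := ih1 h1.2.2 h2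
    obtain ⟨g2, e2⟩ := ih2 h1 h2.2.2
    have g1' : ∀ w ∈ shuffles l₁ (b :: l₂), Good (a :: w) := fun w hw =>
      ⟨h1.1, fun h => absurd h (shuffles_ne _ _ (by simp) w hw), g1 w hw⟩
    have g2' : ∀ w ∈ shuffles (a :: l₁) l₂, Good (b :: w) := fun w hw =>
      ⟨h2.1, fun h => absurd h (shuffles_ne _ _ (by simp) w hw), g2 w hw⟩
    have g3 : ∀ w ∈ shuffles (a :: l₁) (b :: l₂), Good w := by
      intro w hw
      simp only [shuffles, List.mem_append, List.mem_map] at hw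
      rcases hw with ⟨v, hv, rfl⟩ | ⟨v, hv, rfl⟩
      · exact g1' v hv
      · exact g2' v hv
    refine ⟨g3, fun s hs => ?_⟩
    have key := intervalIntegral.integral_eq_sub_of_hasDerivAt_of_le (a := s) (b := 1) hs.2
      (f := fun x => JJ (a :: l₁) x * JJ (b :: l₂) x -
        ((shuffles (a :: l₁) (b :: l₂)).map (JJ · x)).sum) (f' := fun _ => 0)
      ((((JJ_cont _ h1).mul (JJ_cont _ h2)).sub (sum_cont _ g3)).mono
        (Set.Icc_subset_Icc_left hs.1)) ?_ (by simp)
    · have hone : ((shuffles (a :: l₁) (b :: l₂)).map (JJ · 1)).sum = 0 := by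
        rw [shuffles, List.map_append, List.sum_append, sum_one a _ g1', sum_one b _ g2', add_zero]
      simp only [intervalIntegral.integral_zero, hone, JJ_one a l₁ h1] at key
      linear_combination key
    · intro x hx
      have hx' : x ∈ Set.Ioo (0:ℝ) 1 := ⟨hs.1.trans_lt hx.1, hx.2⟩
      have hx'' : x ∈ Set.Icc (0:ℝ) 1 := ⟨hx'.1.le, hx'.2.le⟩
      have d := ((JJ_deriv a l₁ h1 x hx').mul (JJ_deriv b l₂ h2 x hx')).sub
        ((sum_deriv a x hx' _ g1').add (sum_deriv b x hx' _ g2'))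
      rw [← e1 x hx'', ← e2 x hx''] at d
      simp only [shuffles, List.map_append, List.sum_append]
      exact d.congr_deriv (by ring)

lemma good_of (N : ℕ) (hN : 1 ≤ N) (w : List ℂ) (h : w ≠ []) (hw : ∀ x ∈ w, x ^ N = 1)
    (hl : w.getLast h ≠ 1) : Good w := by
  induction w with
  | nil => trivial
  | cons a w ih =>
    refine ⟨Complex.norm_eq_one_of_pow_eq_one (hw a (by simp)) (by omega), ?_, ?_⟩
    · rintro rfl; simpa using hl
    · by_cases hne : w = []
      · subst hne; trivial
      · exact ih hne (fun x hx => hw x (by simp [hx])) (by rwa [List.getLast_cons hne] at hl)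

lemma integrableOn_of_good (w : List ℂ) (h : Good w) :
    IntegrableOn (fun t : Fin w.length → ℝ => ∏ i, (w.get i - (t i : ℂ))⁻¹)
      (openSimplex w.length) :=
  (integrable_indicator_iff (simp_meas w.length 0)).1 (GG_int w 0 (NN_fin w h 0 le_rfl))

lemma wi (w : List ℂ) : wordIntegral w = JJ w 0 :=
  (integral_indicator (simp_meas w.length 0)).symm

/-- Shuffle product formula: for words `w₁, w₂` with letters in `μ_N` whose last letters
are `≠ 1`, all the iterated integrals converge and
`I(w₁)·I(w₂) = ∑_{w shuffle of w₁,w₂} I(w)`. -/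
theorem wordIntegral_shuffle (N : ℕ) (hN : 1 ≤ N) (w₁ w₂ : List ℂ)
    (h₁ : w₁ ≠ []) (h₂ : w₂ ≠ [])
    (hw₁ : ∀ x ∈ w₁, x ^ N = 1) (hw₂ : ∀ x ∈ w₂, x ^ N = 1)
    (hl₁ : w₁.getLast h₁ ≠ 1) (hl₂ : w₂.getLast h₂ ≠ 1) :
    IntegrableOn (fun t : Fin w₁.length → ℝ => ∏ i, (w₁.get i - (t i : ℂ))⁻¹)
      (openSimplex w₁.length) ∧
    IntegrableOn (fun t : Fin w₂.length → ℝ => ∏ i, (w₂.get i - (t i : ℂ))⁻¹)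
      (openSimplex w₂.length) ∧
    (∀ w ∈ shuffles w₁ w₂,
      IntegrableOn (fun t : Fin w.length → ℝ => ∏ i, (w.get i - (t i : ℂ))⁻¹)
        (openSimplex w.length)) ∧
    wordIntegral w₁ * wordIntegral w₂ = ((shuffles w₁ w₂).map wordIntegral).sum := by
  have g1 := good_of N hN w₁ h₁ hw₁ hl₁
  have g2 := good_of N hN w₂ h₂ hw₂ hl₂
  obtain ⟨hg, he⟩ := shuffle_main w₁ w₂ g1 g2
  refine ⟨integrableOn_of_good _ g1, integrableOn_of_good _ g2, fun w hw => integrableOn_of_good w (hg w hw), ?_⟩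
  rw [wi, wi, he 0 (by simp)]
  simp only [funext wi]
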